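/- Let q > 2 be a real number, m ≥ 2 an integer, n = m + 2, and suppose m^{−2/q} + m^{−(q−2)/(q(q−1))} ≤ 1. Let D ∈ ℝ^{m×n} be the matrix whose i-th row (written as a vector r_i^D ∈ ℝ^n) is r_i^D = m^{−1/q} e_1 + m^{−(q−2)/(2q(q−1))} e_2 + [1 − m^{−2/q} − m^{−(q−2)/(q(q−1))}]^{1/2} e_{i+2} for 1 ≤ i ≤ ⌊m^{(q−2)/(q−1)}⌋, and r_i^D = m^{−1/q} e_1 + [1 − m^{−2/q}]^{1/2} e_{i+2} for ⌊m^{(q−2)/(q−1)}⌋ + 1 ≤ i ≤ m, where e_1,…,e_n are the standard basis vectors of ℝ^n. Then every row of D has unit 2-norm, and ‖D‖_{2→q} ≥ ‖D e_2‖_q ≥ 2^{−1/q} · m^{(q−2)/(2q(q−1))}. -/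

import Mathlib

open scoped BigOperators

/-- The `ℓ_p` norm of a vector, for a real exponent `p`. -/
noncomputable def lpnorm {n : ℕ} {𝕜 : Type*} [RCLike 𝕜] (p : ℝ) (x : Fin n → 𝕜) : ℝ :=
  (∑ i, ‖x i‖ ^ p) ^ (1 / p)

/-- The `ℓ_∞` norm of a vector. -/
noncomputable def linorm {n : ℕ} {𝕜 : Type*} [RCLike 𝕜] (x : Fin n → 𝕜) : ℝ :=
  ⨆ i, ‖x i‖

/-- The `p → q` operator norm of a matrix: `max_{x ≠ 0} ‖Ax‖_q / ‖x‖_p`. -/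
noncomputable def opNorm {m n : ℕ} {𝕜 : Type*} [RCLike 𝕜] (p q : ℝ)
    (A : Matrix (Fin m) (Fin n) 𝕜) : ℝ :=
  ⨆ x : {x : Fin n → 𝕜 // x ≠ 0}, lpnorm q (A.mulVec x.1) / lpnorm p x.1

/-- The `p → ∞` operator norm of a matrix: `max_{x ≠ 0} ‖Ax‖_∞ / ‖x‖_p`. -/
noncomputable def opNormInf {m n : ℕ} {𝕜 : Type*} [RCLike 𝕜] (p : ℝ)
    (A : Matrix (Fin m) (Fin n) 𝕜) : ℝ :=
  ⨆ x : {x : Fin n → 𝕜 // x ≠ 0}, linorm (A.mulVec x.1) / lpnorm p x.1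

/-- `row A i` is the conjugate transpose of the `i`-th row of `A`,
so that `(A x) i = ⟨x, row A i⟩` for the standard Hermitian inner product. -/
def row {m n : ℕ} {𝕜 : Type*} [RCLike 𝕜] (A : Matrix (Fin m) (Fin n) 𝕜) (i : Fin m) :
    Fin n → 𝕜 := fun k => star (A i k)

/-- The standard Hermitian inner product `⟨x, y⟩ = ∑ k, x k * conj (y k)`. -/
noncomputable def hinner {n : ℕ} (x y : Fin n → ℂ) : ℂ := ∑ k, x k * star (y k)

section

variable {m n : ℕ} {𝕜 : Type*} [RCLike 𝕜]

lemma lpnorm_nonneg (p : ℝ) (x : Fin n → 𝕜) : 0 ≤ lpnorm p x := by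
  unfold lpnorm; positivity

lemma lpnorm_smul {p : ℝ} (hp : 0 < p) (c : 𝕜) (x : Fin n → 𝕜) :
    lpnorm p (c • x) = ‖c‖ * lpnorm p x := by
  have h : ∀ i, ‖(c • x) i‖ ^ p = ‖c‖ ^ p * ‖x i‖ ^ p := fun i => by
    rw [Pi.smul_apply, norm_smul, Real.mul_rpow (norm_nonneg _) (norm_nonneg _)]
  simp only [lpnorm, h]
  rw [← Finset.mul_sum, Real.mul_rpow (by positivity) (by positivity),
    ← Real.rpow_mul (norm_nonneg _), mul_one_div_cancel hp.ne', Real.rpow_one]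

lemma lpnorm_mono {p : ℝ} (hp : 0 < p) {𝕜' : Type*} [RCLike 𝕜'] {x : Fin n → 𝕜}
    {y : Fin n → 𝕜'} (h : ∀ i, ‖x i‖ ≤ ‖y i‖) : lpnorm p x ≤ lpnorm p y := by
  unfold lpnorm
  gcongr
  exact h _

lemma norm_le_lpnorm {p : ℝ} (hp : 0 < p) (x : Fin n → 𝕜) (i : Fin n) :
    ‖x i‖ ≤ lpnorm p x := by
  have h : ‖x i‖ ^ p ≤ ∑ j, ‖x j‖ ^ p :=
    Finset.single_le_sum (f := fun j => ‖x j‖ ^ p) (fun j _ => by positivity) (Finset.mem_univ i)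
  calc ‖x i‖ = (‖x i‖ ^ p) ^ (1 / p) := by
        rw [← Real.rpow_mul (norm_nonneg _), mul_one_div_cancel hp.ne', Real.rpow_one]
    _ ≤ _ := Real.rpow_le_rpow (by positivity) h (by positivity)

lemma lpnorm_single {p : ℝ} (hp : 0 < p) (i : Fin n) :
    lpnorm p (Pi.single i 1 : Fin n → 𝕜) = 1 := by
  have h : ∀ j, ‖(Pi.single i 1 : Fin n → 𝕜) j‖ ^ p = if j = i then 1 else 0 := fun j => by
    by_cases hj : j = i <;> simp [hj, hp.ne']
  simp [lpnorm, h]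

/-- The quotients defining the operator norm are bounded, so that the supremum is genuine. -/
lemma bddAbove_opNorm {p q : ℝ} (hp : 0 < p) (hq : 0 < q) (A : Matrix (Fin m) (Fin n) 𝕜) :
    BddAbove (Set.range fun x : {x : Fin n → 𝕜 // x ≠ 0} =>
      lpnorm q (A.mulVec x.1) / lpnorm p x.1) := by
  refine ⟨lpnorm q fun i => ∑ k, ‖A i k‖, ?_⟩
  rintro _ ⟨⟨x, -⟩, rfl⟩
  refine div_le_of_le_mul₀ (lpnorm_nonneg _ _) (lpnorm_nonneg _ _) ?_
  calc lpnorm q (A.mulVec x)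
      ≤ lpnorm q (lpnorm p x • fun i => ∑ k, ‖A i k‖) := by
        refine lpnorm_mono hq fun i => ?_
        refine le_trans ?_ (Real.le_norm_self _)
        rw [Pi.smul_apply, smul_eq_mul, Finset.mul_sum, Matrix.mulVec_eq_sum, Finset.sum_apply]
        refine (norm_sum_le _ _).trans (Finset.sum_le_sum fun k _ => ?_)
        rw [Pi.smul_apply, norm_smul]
        exact mul_le_mul_of_nonneg_right (norm_le_lpnorm hp x k) (norm_nonneg _)
    _ = _ := by
        rw [lpnorm_smul hq, Real.norm_of_nonneg (lpnorm_nonneg _ _), mul_comm]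

lemma lpnorm_col_le_opNorm {p q : ℝ} (hp : 0 < p) (hq : 0 < q) (A : Matrix (Fin m) (Fin n) 𝕜)
    (k : Fin n) : lpnorm q (fun i => A i k) ≤ opNorm p q A := by
  have h0 : (Pi.single k 1 : Fin n → 𝕜) ≠ 0 := by simp
  have h := le_ciSup (bddAbove_opNorm hp hq A) ⟨_, h0⟩
  simp only [lpnorm_single hp, div_one, Matrix.mulVec_single_one] at h
  exact h

end

lemma lpnorm_two_eq_one {n : ℕ} {x : Fin n → ℝ} (h : ∑ i, x i ^ 2 = 1) : lpnorm 2 x = 1 := by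
  simp [lpnorm, h]

lemma half_le_floor {t : ℝ} (ht : 1 ≤ t) : t / 2 ≤ (⌊t⌋₊ : ℝ) := by
  have h1 : (1 : ℝ) ≤ ⌊t⌋₊ := by exact_mod_cast (Nat.one_le_floor_iff t).2 ht
  linarith [Nat.lt_floor_add_one t]

/-- The `q`-norm of a vector equal to `c` on its first `F` coordinates and zero elsewhere. -/
lemma lpnorm_ite_lt {m F : ℕ} (hF : F ≤ m) {q c : ℝ} (hq : 0 < q) (hc : 0 ≤ c) :
    lpnorm q (fun i : Fin m => if (i : ℕ) < F then c else 0) = ((F : ℝ) * c ^ q) ^ (1 / q) := by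
  have h : ∀ i : Fin m, ‖(if (i : ℕ) < F then c else 0 : ℝ)‖ ^ q =
      if (i : ℕ) < F then c ^ q else 0 := fun i => by
    split_ifs
    · rw [Real.norm_of_nonneg hc]
    · simp [hq.ne']
  simp only [lpnorm, h]
  rw [← Finset.sum_filter, Finset.sum_const, nsmul_eq_mul, Fin.card_filter_val_lt,
    min_eq_right hF]

theorem stmt18 {m : ℕ} (hm : 2 ≤ m) (q : ℝ) (hq : 2 < q)
    (hsum : (m : ℝ) ^ (-(2 / q)) + (m : ℝ) ^ (-((q - 2) / (q * (q - 1)))) ≤ 1)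
    (D : Matrix (Fin m) (Fin (m + 2)) ℝ)
    (hD : D = Matrix.of fun (i : Fin m) (k : Fin (m + 2)) =>
      if (k : ℕ) = 0 then (m : ℝ) ^ (-(1 / q))
      else if (k : ℕ) = 1 then
        (if (i : ℕ) < Nat.floor ((m : ℝ) ^ ((q - 2) / (q - 1))) then
          (m : ℝ) ^ (-((q - 2) / (2 * q * (q - 1)))) else 0)
      else if (k : ℕ) = (i : ℕ) + 2 then
        (if (i : ℕ) < Nat.floor ((m : ℝ) ^ ((q - 2) / (q - 1))) then
          Real.sqrt (1 - (m : ℝ) ^ (-(2 / q)) - (m : ℝ) ^ (-((q - 2) / (q * (q - 1)))))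
        else Real.sqrt (1 - (m : ℝ) ^ (-(2 / q))))
      else 0) :
    (∀ i : Fin m, lpnorm 2 (fun k => D i k) = 1) ∧
      opNorm 2 q D ≥ lpnorm q (fun i => D i 1) ∧
      lpnorm q (fun i => D i 1) ≥
        (2 : ℝ) ^ (-(1 / q)) * (m : ℝ) ^ ((q - 2) / (2 * q * (q - 1))) := by
  have hm0 : (0 : ℝ) < m := by exact_mod_cast (by omega : 0 < m)
  have hm1 : (1 : ℝ) ≤ m := by exact_mod_cast (by omega : 1 ≤ m)
  have hq0 : 0 < q := by linarith
  have hq1 : 0 < q - 1 := by linarith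
  have hq2 : 0 < q - 2 := by linarith
  have hsq₀ : ((m : ℝ) ^ (-(1 / q))) ^ 2 = (m : ℝ) ^ (-(2 / q)) := by
    rw [← Real.rpow_mul_natCast hm0.le]
    congr 1
    push_cast
    ring
  have hsq₁ : ((m : ℝ) ^ (-((q - 2) / (2 * q * (q - 1))))) ^ 2 =
      (m : ℝ) ^ (-((q - 2) / (q * (q - 1)))) := by
    rw [← Real.rpow_mul_natCast hm0.le]
    congr 1
    push_cast
    field_simp
  refine ⟨fun i => lpnorm_two_eq_one ?_, lpnorm_col_le_opNorm two_pos hq0 D 1, ?_⟩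
  · have hpos : 0 < (m : ℝ) ^ (-((q - 2) / (q * (q - 1)))) := by positivity
    have hs₁ : 0 ≤ 1 - (m : ℝ) ^ (-(2 / q)) - (m : ℝ) ^ (-((q - 2) / (q * (q - 1)))) := by
      linarith
    have hs₂ : 0 ≤ 1 - (m : ℝ) ^ (-(2 / q)) := by linarith
    rw [Fin.sum_univ_succ, Fin.sum_univ_succ, Finset.sum_eq_single i]
    · by_cases hi : (i : ℕ) < ⌊(m : ℝ) ^ ((q - 2) / (q - 1))⌋₊
      · simp [hD, hi, hsq₀, hsq₁, Real.sq_sqrt hs₁, -one_div]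
      · simp [hD, hi, hsq₀, Real.sq_sqrt hs₂, -one_div]
    · intro j _ hj
      have hj' : (j : ℕ) ≠ i := fun h => hj (Fin.ext h)
      simp [hD, hj']
    · simp
  · set t : ℝ := (m : ℝ) ^ ((q - 2) / (q - 1)) with ht
    have ht1 : 1 ≤ t := Real.one_le_rpow hm1 (by positivity)
    have htm : t ≤ m := by
      refine (Real.rpow_le_rpow_of_exponent_le hm1 ?_).trans_eq (Real.rpow_one _)
      rw [div_le_one hq1]
      linarith
    have hF : ⌊t⌋₊ ≤ m := Nat.floor_le_of_le htm
    have hcol : (fun i => D i 1) = fun i : Fin m => if (i : ℕ) < ⌊t⌋₊ then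
        (m : ℝ) ^ (-((q - 2) / (2 * q * (q - 1)))) else 0 := by
      funext i
      simp [hD]
    rw [hcol, lpnorm_ite_lt hF hq0 (by positivity), ge_iff_le]
    have hkey : (2 : ℝ) ^ (-(1 / q)) * (m : ℝ) ^ ((q - 2) / (2 * q * (q - 1))) =
        (t / 2 * ((m : ℝ) ^ (-((q - 2) / (2 * q * (q - 1))))) ^ q) ^ (1 / q) := by
      rw [div_eq_inv_mul t, mul_assoc 2⁻¹ t, Real.mul_rpow (by positivity) (by positivity), ht,
        ← Real.rpow_mul hm0.le, ← Real.rpow_add hm0, ← Real.rpow_mul hm0.le,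
        Real.inv_rpow two_pos.le, ← Real.rpow_neg two_pos.le]
      congr 2
      field_simp
      ring
    rw [hkey]
    gcongr
    exact half_le_floor ht1
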